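/- For every real z ≠ 0, the posterior mean of the nonzero component under the quasi-Cauchy prior satisfies μ₁(z) := (∫_ℝ u γ(u) φ(z − u) du) / (∫_ℝ γ(u) φ(z − u) du) = z (1 − e^{-z²/2})^{-1} − 2 z^{-1}; equivalently, ∫_ℝ u γ(u) φ(z − u) du = (2π)^{-1/2} (z^{-1} − 2 z^{-3} (1 − e^{-z²/2})). -/

import Mathlib

open MeasureTheory Real Filter

/-- The standard normal density. -/
noncomputable def phi (x : ℝ) : ℝ := (Real.sqrt (2 * Real.pi))⁻¹ * Real.exp (-x ^ 2 / 2)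

/-- The standard normal cumulative distribution function. -/
noncomputable def Phi (x : ℝ) : ℝ := ∫ t in Set.Iic x, phi t

/-- The upper tail of the standard normal distribution. -/
noncomputable def PhiBar (x : ℝ) : ℝ := 1 - Phi x

/-- The quasi-Cauchy density. -/
noncomputable def quasiCauchy (u : ℝ) : ℝ :=
  (Real.sqrt (2 * Real.pi))⁻¹ * (1 - |u| * PhiBar |u| / phi u)

open Topology Asymptotics

lemma continuous_phi : Continuous phi := by
  unfold phi
  fun_prop

lemma phi_nonneg (x : ℝ) : 0 ≤ phi x := by
  unfold phi
  positivity

lemma phi_pos (x : ℝ) : 0 < phi x := by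
  unfold phi
  positivity

lemma phi_neg (x : ℝ) : phi (-x) = phi x := by
  simp [phi]

lemma phi_eq_gaussianPDFReal : phi = ProbabilityTheory.gaussianPDFReal 0 1 := by
  ext x
  simp [phi, ProbabilityTheory.gaussianPDFReal]

lemma integrable_phi : Integrable phi := by
  rw [phi_eq_gaussianPDFReal]
  exact ProbabilityTheory.integrable_gaussianPDFReal 0 1

lemma integral_phi : ∫ x, phi x = 1 := by
  rw [phi_eq_gaussianPDFReal]
  exact ProbabilityTheory.integral_gaussianPDFReal_eq_one 0 one_ne_zero

lemma phi_sub (z u : ℝ) : phi (z - u) = phi u * exp (z * u) * exp (-z ^ 2 / 2) := by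
  simp only [phi, mul_assoc, ← exp_add]
  ring_nf

lemma exp_neg_sq_div_two_mul_exp (z : ℝ) : exp (-z ^ 2 / 2) * exp (z ^ 2 / 2) = 1 := by
  rw [← exp_add, neg_div, neg_add_cancel, exp_zero]

lemma integral_phi_mul_exp (z : ℝ) : ∫ u, phi u * exp (z * u) = exp (z ^ 2 / 2) := by
  have h : ∀ u, phi u * exp (z * u) = exp (z ^ 2 / 2) * phi (z - u) := fun u => by
    rw [phi_sub]
    linear_combination -(phi u * exp (z * u)) * exp_neg_sq_div_two_mul_exp z
  simp_rw [h]
  rw [integral_const_mul, integral_sub_left_eq_self phi volume z, integral_phi, mul_one]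

lemma PhiBar_eq_integral_Ioi (x : ℝ) : PhiBar x = ∫ t in Set.Ioi x, phi t := by
  rw [PhiBar, Phi, ← integral_phi, ← intervalIntegral.integral_Iic_add_Ioi (b := x)
    integrable_phi.integrableOn integrable_phi.integrableOn]
  ring

lemma PhiBar_zero : PhiBar 0 = 1 / 2 := by
  have h := integral_comp_neg_Ioi 0 phi
  simp only [phi_neg, neg_zero] at h
  have h' := PhiBar_eq_integral_Ioi 0
  rw [h] at h'
  rw [PhiBar, Phi] at h' ⊢
  linarith

lemma hasDerivAt_PhiBar (x : ℝ) : HasDerivAt PhiBar (-phi x) x := by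
  have h : PhiBar = fun y => PhiBar 0 - ∫ t in (0 : ℝ)..y, phi t := by
    ext y
    rw [← intervalIntegral.integral_Iic_sub_Iic integrable_phi.integrableOn
      integrable_phi.integrableOn, PhiBar, PhiBar, Phi, Phi]
    ring
  rw [h]
  exact (continuous_phi.integral_hasStrictDerivAt 0 x).hasDerivAt.const_sub _

lemma continuous_PhiBar : Continuous PhiBar :=
  continuous_iff_continuousAt.2 fun x => (hasDerivAt_PhiBar x).continuousAt

lemma hasDerivAt_phi (x : ℝ) : HasDerivAt phi (-x * phi x) x := by
  have h : HasDerivAt (fun x : ℝ => -x ^ 2 / 2) (-x) x := by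
    convert! ((hasDerivAt_pow 2 x).neg.div_const 2) using 1
    ring
  unfold phi
  convert! h.exp.const_mul (√(2 * π))⁻¹ using 1
  ring

lemma phi_le_exp (a x : ℝ) : phi x ≤ (√(2 * π))⁻¹ * exp (a ^ 2 / 2) * exp (-a * x) := by
  rw [phi, mul_assoc, ← exp_add]
  gcongr
  nlinarith [sq_nonneg (x - a)]

lemma phi_isBigO_exp (a : ℝ) : phi =O[atTop] fun x => exp (-a * x) :=
  IsBigO.of_bound _ <| Eventually.of_forall fun x => by
    simpa [abs_of_nonneg (phi_nonneg x)] using phi_le_exp a x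

lemma PhiBar_isBigO_exp {a : ℝ} (ha : 0 < a) : PhiBar =O[atTop] fun x => exp (-a * x) := by
  refine IsBigO.of_bound ((√(2 * π))⁻¹ * exp (a ^ 2 / 2) / a) <| Eventually.of_forall fun x => ?_
  have ha' : -a < 0 := neg_lt_zero.2 ha
  rw [PhiBar_eq_integral_Ioi, norm_eq_abs, norm_eq_abs, abs_exp,
    abs_of_nonneg (setIntegral_nonneg measurableSet_Ioi fun t _ => phi_nonneg t)]
  calc ∫ t in Set.Ioi x, phi t
      ≤ ∫ t in Set.Ioi x, (√(2 * π))⁻¹ * exp (a ^ 2 / 2) * exp (-a * t) :=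
        setIntegral_mono_on integrable_phi.integrableOn
          ((integrableOn_exp_mul_Ioi ha' x).const_mul _) measurableSet_Ioi
          fun t _ => phi_le_exp a t
    _ = _ := by
        rw [integral_const_mul, integral_exp_mul_Ioi ha']
        field_simp

lemma pow_mul_mul_exp_isBigO {f : ℝ → ℝ} (hf : ∀ a > 0, f =O[atTop] fun x => exp (-a * x))
    (n : ℕ) (z : ℝ) :
    (fun x => x ^ n * (f x * exp (z * x))) =O[atTop] fun x => exp (-1 * x) := by
  have h₁ := (isLittleO_pow_exp_pos_mul_atTop n one_pos).isBigO.mul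
    ((hf (|z| + 2) (by positivity)).mul (isBigO_refl (fun x => exp (z * x)) atTop))
  refine h₁.trans (IsBigO.of_bound 1 ?_)
  filter_upwards [eventually_ge_atTop 0] with x hx
  simp only [norm_eq_abs, abs_exp, one_mul, ← exp_add]
  gcongr
  nlinarith [le_abs_self z]

lemma tendsto_zero_of_isBigO_exp {f : ℝ → ℝ} (hf : f =O[atTop] fun x => exp (-1 * x)) :
    Tendsto f atTop (𝓝 0) := by
  refine hf.trans_tendsto ?_
  simpa using tendsto_exp_neg_atTop_nhds_zero

lemma phi_moment_isBigO (n : ℕ) (z : ℝ) :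
    (fun x => x ^ n * (phi x * exp (z * x))) =O[atTop] fun x => exp (-1 * x) :=
  pow_mul_mul_exp_isBigO (fun a _ => phi_isBigO_exp a) n z

lemma PhiBar_moment_isBigO (n : ℕ) (z : ℝ) :
    (fun x => x ^ n * (PhiBar x * exp (z * x))) =O[atTop] fun x => exp (-1 * x) :=
  pow_mul_mul_exp_isBigO (fun _ ha => PhiBar_isBigO_exp ha) n z

lemma integrableOn_phi_moment (n : ℕ) (z : ℝ) :
    IntegrableOn (fun x => x ^ n * (phi x * exp (z * x))) (Set.Ioi 0) :=
  integrable_of_isBigO_exp_neg one_pos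
    (by have := continuous_phi; fun_prop) (phi_moment_isBigO n z)

lemma integrableOn_PhiBar_moment (n : ℕ) (z : ℝ) :
    IntegrableOn (fun x => x ^ n * (PhiBar x * exp (z * x))) (Set.Ioi 0) :=
  integrable_of_isBigO_exp_neg one_pos
    (by have := continuous_PhiBar; fun_prop) (PhiBar_moment_isBigO n z)

lemma integrableOn_moment (n : ℕ) (z : ℝ) :
    IntegrableOn (fun u => u ^ n * ((phi u - u * PhiBar u) * exp (z * u))) (Set.Ioi 0) := by
  refine ((integrableOn_phi_moment n z).sub (integrableOn_PhiBar_moment (n + 1) z)).congr_fun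
    (fun u _ => ?_) measurableSet_Ioi
  simp only [Pi.sub_apply]
  ring

lemma hasDerivAt_exp_mul (z x : ℝ) : HasDerivAt (fun u => exp (z * u)) (z * exp (z * x)) x := by
  have h := ((hasDerivAt_id x).const_mul z).exp
  simp only [id, mul_one] at h
  rwa [mul_comm] at h

lemma integral_Ioi_moment_zero {z : ℝ} (hz : z ≠ 0) :
    ∫ u in Set.Ioi 0, u ^ 0 * ((phi u - u * PhiBar u) * exp (z * u)) =
      -(1 / (2 * z ^ 2)) - phi 0 / z + (∫ u in Set.Ioi 0, phi u * exp (z * u)) / z ^ 2 := by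
  have hE := integrableOn_phi_moment 0 z
  simp only [pow_zero, one_mul] at hE
  have hD : ∀ x ∈ Set.Ici (0 : ℝ), HasDerivAt
      (fun u => -(u ^ 1 * (PhiBar u * exp (z * u))) / z + (u ^ 0 * (PhiBar u * exp (z * u))) / z ^ 2
        + (u ^ 0 * (phi u * exp (z * u))) / z)
      (x ^ 0 * ((phi x - x * PhiBar x) * exp (z * x)) - phi x * exp (z * x) / z ^ 2) x := by
    intro x _
    have hQ := (hasDerivAt_PhiBar x).mul (hasDerivAt_exp_mul z x)
    have hP := (hasDerivAt_phi x).mul (hasDerivAt_exp_mul z x)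
    convert! ((((hasDerivAt_pow 1 x).mul hQ).neg.div_const z).add
      (((hasDerivAt_pow 0 x).mul hQ).div_const (z ^ 2))).add
      (((hasDerivAt_pow 0 x).mul hP).div_const z) using 1
    simp
    field_simp
    ring
  have hT := (((tendsto_zero_of_isBigO_exp (PhiBar_moment_isBigO 1 z)).neg.div_const z).add
    ((tendsto_zero_of_isBigO_exp (PhiBar_moment_isBigO 0 z)).div_const (z ^ 2))).add
    ((tendsto_zero_of_isBigO_exp (phi_moment_isBigO 0 z)).div_const z)
  have h := integral_Ioi_of_hasDerivAt_of_tendsto' hD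
    ((integrableOn_moment 0 z).sub (hE.div_const (z ^ 2))) hT
  rw [integral_sub (integrableOn_moment 0 z) (hE.div_const (z ^ 2)), integral_div] at h
  rw [← sub_eq_iff_eq_add, h]
  simp [PhiBar_zero]
  field_simp
  ring

lemma integral_Ioi_moment_one {z : ℝ} (hz : z ≠ 0) :
    ∫ u in Set.Ioi 0, u ^ 1 * ((phi u - u * PhiBar u) * exp (z * u)) =
      1 / z ^ 3 + 2 * phi 0 / z ^ 2
        + (1 / z - 2 / z ^ 3) * ∫ u in Set.Ioi 0, phi u * exp (z * u) := by
  have hE := integrableOn_phi_moment 0 z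
  simp only [pow_zero, one_mul] at hE
  have hD : ∀ x ∈ Set.Ici (0 : ℝ), HasDerivAt
      (fun u => -(u ^ 2 * (PhiBar u * exp (z * u))) / z
        + 2 / z ^ 2 * (u ^ 1 * (PhiBar u * exp (z * u)))
        - 2 / z ^ 3 * (u ^ 0 * (PhiBar u * exp (z * u)))
        + (u ^ 1 * (phi u * exp (z * u))) / z - 2 / z ^ 2 * (u ^ 0 * (phi u * exp (z * u))))
      (x ^ 1 * ((phi x - x * PhiBar x) * exp (z * x))
        - (1 / z - 2 / z ^ 3) * (phi x * exp (z * x))) x := by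
    intro x _
    have hQ := (hasDerivAt_PhiBar x).mul (hasDerivAt_exp_mul z x)
    have hP := (hasDerivAt_phi x).mul (hasDerivAt_exp_mul z x)
    convert! ((((((hasDerivAt_pow 2 x).mul hQ).neg.div_const z).add
      (((hasDerivAt_pow 1 x).mul hQ).const_mul (2 / z ^ 2))).sub
      (((hasDerivAt_pow 0 x).mul hQ).const_mul (2 / z ^ 3))).add
      (((hasDerivAt_pow 1 x).mul hP).div_const z)).sub
      (((hasDerivAt_pow 0 x).mul hP).const_mul (2 / z ^ 2)) using 1
    simp
    field_simp
    ring
  have hT := (((((tendsto_zero_of_isBigO_exp (PhiBar_moment_isBigO 2 z)).neg.div_const z).add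
    ((tendsto_zero_of_isBigO_exp (PhiBar_moment_isBigO 1 z)).const_mul (2 / z ^ 2))).sub
    ((tendsto_zero_of_isBigO_exp (PhiBar_moment_isBigO 0 z)).const_mul (2 / z ^ 3))).add
    ((tendsto_zero_of_isBigO_exp (phi_moment_isBigO 1 z)).div_const z)).sub
    ((tendsto_zero_of_isBigO_exp (phi_moment_isBigO 0 z)).const_mul (2 / z ^ 2))
  have h := integral_Ioi_of_hasDerivAt_of_tendsto' hD
    ((integrableOn_moment 1 z).sub (hE.const_mul _)) hT
  rw [integral_sub (integrableOn_moment 1 z) (hE.const_mul _), integral_const_mul] at h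
  rw [← sub_eq_iff_eq_add, h]
  simp [PhiBar_zero]
  field_simp
  ring

lemma integral_eq_integral_Ioi_add_integral_Ioi_neg {f : ℝ → ℝ} (hf : IntegrableOn f (Set.Ioi 0))
    (hf' : IntegrableOn (fun x => f (-x)) (Set.Ioi 0)) :
    ∫ x, f x = (∫ x in Set.Ioi 0, f x) + ∫ x in Set.Ioi 0, f (-x) := by
  have h : IntegrableOn f (Set.Iic 0) := by
    rw [← integrableOn_Ici_iff_integrableOn_Ioi] at hf'
    have := (Measure.measurePreserving_neg (volume : Measure ℝ)).integrableOn_comp_preimage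
      (Homeomorph.neg ℝ).measurableEmbedding (f := f) (s := Set.Iic 0)
    rw [← this]
    simpa [Function.comp_def] using hf'
  rw [integral_comp_neg_Ioi, neg_zero, add_comm, intervalIntegral.integral_Iic_add_Ioi h hf]

lemma integral_phi_mul_exp_eq_add (z : ℝ) :
    (∫ u in Set.Ioi 0, phi u * exp (z * u)) + ∫ u in Set.Ioi 0, phi u * exp (-z * u) =
      exp (z ^ 2 / 2) := by
  have h₁ := integrableOn_phi_moment 0 z
  have h₂ := integrableOn_phi_moment 0 (-z)
  simp only [pow_zero, one_mul] at h₁ h₂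
  rw [← integral_phi_mul_exp, integral_eq_integral_Ioi_add_integral_Ioi_neg h₁]
  · simp [phi_neg]
  · simpa [phi_neg] using h₂

lemma quasiCauchy_mul_phi_sub (z u : ℝ) :
    quasiCauchy u * phi (z - u) = (√(2 * π))⁻¹ * exp (-z ^ 2 / 2) *
      ((phi u - |u| * PhiBar |u|) * exp (z * u)) := by
  have := (phi_pos u).ne'
  rw [phi_sub, quasiCauchy]
  field_simp

lemma integral_pow_mul_quasiCauchy (n : ℕ) (z : ℝ) :
    ∫ u, u ^ n * quasiCauchy u * phi (z - u) = (√(2 * π))⁻¹ * exp (-z ^ 2 / 2) *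
      ((∫ u in Set.Ioi 0, u ^ n * ((phi u - u * PhiBar u) * exp (z * u))) +
        (-1) ^ n * ∫ u in Set.Ioi 0, u ^ n * ((phi u - u * PhiBar u) * exp (-z * u))) := by
  have h₁ : Set.EqOn (fun u => u ^ n * ((phi u - u * PhiBar u) * exp (z * u)))
      (fun u => u ^ n * ((phi u - |u| * PhiBar |u|) * exp (z * u))) (Set.Ioi 0) :=
    fun u hu => by simp only [abs_of_pos (Set.mem_Ioi.1 hu)]
  have h₂ : Set.EqOn (fun u => (-1) ^ n * (u ^ n * ((phi u - u * PhiBar u) * exp (-z * u))))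
      (fun u => (-u) ^ n * ((phi (-u) - |-u| * PhiBar |-u|) * exp (z * -u))) (Set.Ioi 0) :=
    fun u hu => by
      simp only [abs_neg, abs_of_pos (Set.mem_Ioi.1 hu), phi_neg, neg_pow u n]
      ring_nf
  have h : ∀ u, u ^ n * quasiCauchy u * phi (z - u) = (√(2 * π))⁻¹ * exp (-z ^ 2 / 2) *
      (u ^ n * ((phi u - |u| * PhiBar |u|) * exp (z * u))) := fun u => by
    rw [mul_assoc, quasiCauchy_mul_phi_sub]
    ring
  simp_rw [h]
  rw [integral_const_mul, integral_eq_integral_Ioi_add_integral_Ioi_neg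
    ((integrableOn_moment n z).congr_fun h₁ measurableSet_Ioi)
    (IntegrableOn.congr_fun ((integrableOn_moment n (-z)).const_mul _) h₂ measurableSet_Ioi),
    ← setIntegral_congr_fun measurableSet_Ioi h₁, ← setIntegral_congr_fun measurableSet_Ioi h₂,
    integral_const_mul]

/-- The marginal density of the data under the quasi-Cauchy prior. -/
lemma integral_quasiCauchy_mul_phi {z : ℝ} (hz : z ≠ 0) :
    ∫ u, quasiCauchy u * phi (z - u) =
      (√(2 * π))⁻¹ * ((z ^ 2)⁻¹ * (1 - exp (-z ^ 2 / 2))) := by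
  have h := integral_pow_mul_quasiCauchy 0 z
  rw [integral_Ioi_moment_zero hz, integral_Ioi_moment_zero (neg_ne_zero.2 hz)] at h
  have hI := integral_phi_mul_exp_eq_add z
  have he := exp_neg_sq_div_two_mul_exp z
  rw [neg_div] at he
  simp only [pow_zero, one_mul] at h
  rw [h, eq_sub_of_add_eq hI]
  simp only [mul_assoc]
  congr 1
  field_simp
  linear_combination 2 * he

lemma integral_mul_quasiCauchy_mul_phi {z : ℝ} (hz : z ≠ 0) :
    ∫ u, u * quasiCauchy u * phi (z - u) =
      (√(2 * π))⁻¹ * (z⁻¹ - 2 * (z ^ 3)⁻¹ * (1 - exp (-z ^ 2 / 2))) := by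
  have h := integral_pow_mul_quasiCauchy 1 z
  rw [integral_Ioi_moment_one hz, integral_Ioi_moment_one (neg_ne_zero.2 hz)] at h
  have hI := integral_phi_mul_exp_eq_add z
  have he := exp_neg_sq_div_two_mul_exp z
  rw [neg_div] at he
  simp only [pow_one] at h
  rw [h, eq_sub_of_add_eq hI]
  simp only [mul_assoc]
  congr 1
  field_simp
  linear_combination (z ^ 2 - 2) * he

/-- The posterior mean of the nonzero component under the quasi-Cauchy prior. -/
theorem quasiCauchy_posterior_mean (z : ℝ) (hz : z ≠ 0) :
    (∫ u : ℝ, u * quasiCauchy u * phi (z - u)) / (∫ u : ℝ, quasiCauchy u * phi (z - u))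
        = z * (1 - Real.exp (-z ^ 2 / 2))⁻¹ - 2 * z⁻¹ ∧
    (∫ u : ℝ, u * quasiCauchy u * phi (z - u))
        = (Real.sqrt (2 * Real.pi))⁻¹ *
            (z⁻¹ - 2 * (z ^ 3)⁻¹ * (1 - Real.exp (-z ^ 2 / 2))) := by
  have he : 1 - exp (-z ^ 2 / 2) ≠ 0 :=
    (sub_pos.2 (exp_lt_one_iff.2 (by have := sq_pos_of_ne_zero hz; linarith))).ne'
  refine ⟨?_, integral_mul_quasiCauchy_mul_phi hz⟩
  rw [integral_mul_quasiCauchy_mul_phi hz, integral_quasiCauchy_mul_phi hz,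
    mul_div_mul_left _ _ (by positivity)]
  generalize 1 - exp (-z ^ 2 / 2) = e at he
  field_simp
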